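/- arXiv:0710.5234 — 6 statements merged into one kernel-verified Lean document; each statement's English description precedes it below -/
import Mathlib

section
/- Let λ be a nonreal complex number. Then ψ(conj λ) equals the adjoint ψ(λ)†, and moreover ψ(conj λ)† ∘ φ(λ) = φ(conj λ)† ∘ ψ(λ) (the pair (φ, ψ) associated with the selfadjoint operator T and the scale L satisfies the symmetry conditions of a normalized Nevanlinna pair). -/
open ContinuousLinearMap

/-- If `T` is selfadjoint, a left inverse of `T - conj z` is the adjoint of any left inverse
of `T - z`. -/
theorem eq_adjoint_of_resolvent {E : Type*} [NormedAddCommGroup E] [InnerProductSpace ℂ E]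
    [CompleteSpace E] {T A B : E →L[ℂ] E} (hT : IsSelfAdjoint T) {z : ℂ}
    (hA : A ∘L (T - z • 1) = 1) (hB : B ∘L (T - starRingEnd ℂ z • 1) = 1) :
    B = adjoint A := by
  have h : (T - starRingEnd ℂ z • 1) * star A = 1 := by
    have := congrArg star (show A * (T - z • 1) = 1 from hA)
    rwa [star_mul, star_sub, star_smul, star_one, hT.star_eq] at this
  exact left_inv_eq_right_inv hB h

/-- The second projection on the Hilbert sum is the adjoint of the second inclusion. -/
theorem adjoint_prod_inr (H L : Type*) [NormedAddCommGroup H] [InnerProductSpace ℂ H]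
    [CompleteSpace H] [NormedAddCommGroup L] [InnerProductSpace ℂ L] [CompleteSpace L] :
    adjoint ((WithLp.prodContinuousLinearEquiv 2 ℂ H L).symm.toContinuousLinearMap ∘L
      ContinuousLinearMap.inr ℂ H L) = ContinuousLinearMap.snd ℂ H L ∘L
      (WithLp.prodContinuousLinearEquiv 2 ℂ H L).toContinuousLinearMap := by
  symm
  rw [eq_adjoint_iff]
  intro x y
  simp [WithLp.prod_inner_apply]

/-- For a bounded selfadjoint operator `T` on the Hilbert space
`H ⊕₂ L` with resolvent `R z = (T - z)⁻¹` for nonreal `z`, the pair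
`ψ z = P_L ∘ R z ∘ ι_L`, `φ z = I + z • ψ z` satisfies `ψ (conj z) = (ψ z)†` and
`(ψ (conj z))† ∘ φ z = (φ (conj z))† ∘ ψ z`. -/
theorem stmt_0
    {H L : Type*} [NormedAddCommGroup H] [InnerProductSpace ℂ H] [CompleteSpace H]
    [NormedAddCommGroup L] [InnerProductSpace ℂ L] [CompleteSpace L]
    (T : WithLp 2 (H × L) →L[ℂ] WithLp 2 (H × L)) (hT : IsSelfAdjoint T)
    (R : ℂ → WithLp 2 (H × L) →L[ℂ] WithLp 2 (H × L))
    (hR : ∀ z : ℂ, z.im ≠ 0 → (T - z • 1) ∘L R z = 1 ∧ R z ∘L (T - z • 1) = 1)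
    (ιL : L →L[ℂ] WithLp 2 (H × L))
    (hιL : ιL = (WithLp.prodContinuousLinearEquiv 2 ℂ H L).symm.toContinuousLinearMap ∘L
      ContinuousLinearMap.inr ℂ H L)
    (PL : WithLp 2 (H × L) →L[ℂ] L)
    (hPL : PL = ContinuousLinearMap.snd ℂ H L ∘L
      (WithLp.prodContinuousLinearEquiv 2 ℂ H L).toContinuousLinearMap)
    (ψ φ : ℂ → L →L[ℂ] L)
    (hψ : ∀ z, ψ z = PL ∘L R z ∘L ιL)
    (hφ : ∀ z, φ z = 1 + z • ψ z)
    (z : ℂ) (hz : z.im ≠ 0) :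
    ψ (starRingEnd ℂ z) = adjoint (ψ z) ∧
      adjoint (ψ (starRingEnd ℂ z)) ∘L φ z = adjoint (φ (starRingEnd ℂ z)) ∘L ψ z := by
  have hadj : adjoint ιL = PL := by rw [hιL, hPL, adjoint_prod_inr]
  have hψadj : ψ (starRingEnd ℂ z) = adjoint (ψ z) := by
    have hR' : R (starRingEnd ℂ z) = adjoint (R z) :=
      eq_adjoint_of_resolvent hT (hR z hz).2 (hR _ (by simpa using hz)).2
    rw [hψ, hψ, hR', adjoint_comp, adjoint_comp, ← hadj, adjoint_adjoint, comp_assoc]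
  refine ⟨hψadj, ?_⟩
  have hφadj : adjoint (φ (starRingEnd ℂ z)) = φ z := by
    rw [hφ, hφ, hψadj, ← star_eq_adjoint, ← star_eq_adjoint, star_add, star_one, star_smul,
      star_star, starRingEnd_apply, star_star]
  rw [hφadj, hψadj, adjoint_adjoint, hφ]
  simp [comp_add, add_comp, one_def]
end

section
/- For all nonreal λ, ω ∈ ℂ, the following operator identity on L holds: ψ(λ) − ψ(conj ω) − (λ − conj ω)·ψ(λ) ∘ ψ(conj ω) = (λ − conj ω)·γ(conj λ)† ∘ γ(conj ω). Equivalently, the Nevanlinna kernel N_ω(λ) := (ψ(λ) − ψ(ω)†)/(λ − conj ω) − ψ(λ)∘ψ(ω)† of the pair (φ, ψ) admits the factorization N_ω(λ) = γ(conj λ)† ∘ γ(conj ω). -/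
open ContinuousLinearMap

/-- The first resolvent identity, for one-sided inverses of `a - z` and `a - w`. -/
theorem sub_eq_smul_mul_of_resolvent {A : Type*} [Ring A] [Algebra ℂ A] {a r s : A} {z w : ℂ}
    (hr : r * (a - z • 1) = 1) (hs : (a - w • 1) * s = 1) :
    r - s = (z - w) • (r * s) := by
  calc r - s = r * ((a - w • 1) * s) - r * (a - z • 1) * s := by rw [hr, hs, mul_one, one_mul]
    _ = r * ((z - w) • (1 : A)) * s := by rw [sub_smul]; noncomm_ring
    _ = (z - w) • (r * s) := by simp

/-- The resolvent of a selfadjoint element satisfies `r(conj z)† = r(z)`. -/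
theorem star_eq_of_resolvent_conj {A : Type*} [Ring A] [StarRing A] [Algebra ℂ A] [StarModule ℂ A]
    {a r s : A} {z : ℂ} (ha : IsSelfAdjoint a) (hr : (a - starRingEnd ℂ z • 1) * r = 1)
    (hs : (a - z • 1) * s = 1) : star r = s := by
  have h : star r * (a - z • 1) = 1 := by simpa [ha.star_eq] using congrArg star hr
  exact left_inv_eq_right_inv h hs

/-- For nonreal `z, w`, the identity
`ψ z - ψ (conj w) - (z - conj w) • (ψ z ∘ ψ (conj w)) = (z - conj w) • (γ (conj z)† ∘ γ (conj w))`
holds, i.e. the Nevanlinna kernel of `(φ, ψ)` factorizes as `γ(conj λ)† ∘ γ(conj ω)`. -/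
theorem stmt_1
    {H L : Type*} [NormedAddCommGroup H] [InnerProductSpace ℂ H] [CompleteSpace H]
    [NormedAddCommGroup L] [InnerProductSpace ℂ L] [CompleteSpace L]
    (T : WithLp 2 (H × L) →L[ℂ] WithLp 2 (H × L)) (hT : IsSelfAdjoint T)
    (R : ℂ → WithLp 2 (H × L) →L[ℂ] WithLp 2 (H × L))
    (hR : ∀ z : ℂ, z.im ≠ 0 → (T - z • 1) ∘L R z = 1 ∧ R z ∘L (T - z • 1) = 1)
    (ιL : L →L[ℂ] WithLp 2 (H × L))
    (hιL : ιL = (WithLp.prodContinuousLinearEquiv 2 ℂ H L).symm.toContinuousLinearMap ∘L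
      ContinuousLinearMap.inr ℂ H L)
    (PL : WithLp 2 (H × L) →L[ℂ] L)
    (hPL : PL = ContinuousLinearMap.snd ℂ H L ∘L
      (WithLp.prodContinuousLinearEquiv 2 ℂ H L).toContinuousLinearMap)
    (PH : WithLp 2 (H × L) →L[ℂ] H)
    (hPH : PH = ContinuousLinearMap.fst ℂ H L ∘L
      (WithLp.prodContinuousLinearEquiv 2 ℂ H L).toContinuousLinearMap)
    (ψ : ℂ → L →L[ℂ] L) (hψ : ∀ z, ψ z = PL ∘L R z ∘L ιL)
    (γ : ℂ → L →L[ℂ] H) (hγ : ∀ z, γ z = PH ∘L R z ∘L ιL)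
    (z w : ℂ) (hz : z.im ≠ 0) (hw : w.im ≠ 0) :
    ψ z - ψ (starRingEnd ℂ w) - (z - starRingEnd ℂ w) • (ψ z ∘L ψ (starRingEnd ℂ w)) =
      (z - starRingEnd ℂ w) • (adjoint (γ (starRingEnd ℂ z)) ∘L γ (starRingEnd ℂ w)) := by
  have hz' : (starRingEnd ℂ z).im ≠ 0 := by simpa using hz
  have hw' : (starRingEnd ℂ w).im ≠ 0 := by simpa using hw
  have inner_resolvent : ∀ u v, inner ℂ (R (starRingEnd ℂ z) u) v = inner ℂ u (R z v) := by
    intro u v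
    rw [← star_eq_of_resolvent_conj hT (hR _ hz').1 (hR z hz).1, star_eq_adjoint,
      adjoint_inner_right]
  have inner_ψ : ∀ (ζ : ℂ) (x y : L), inner ℂ y (ψ ζ x) = inner ℂ (ιL y) (R ζ (ιL x)) := by
    intro ζ x y
    simp [hψ, hPL, hιL, WithLp.prod_inner_apply]
  have inner_ψ_left : ∀ x y : L,
      inner ℂ y (ψ z x) = inner ℂ (ψ (starRingEnd ℂ z) y) x := by
    intro x y
    rw [inner_ψ, ← inner_resolvent]
    simp [hψ, hPL, hιL, WithLp.prod_inner_apply]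
  have inner_add : ∀ x y : L,
      inner ℂ (γ (starRingEnd ℂ z) y) (γ (starRingEnd ℂ w) x) +
        inner ℂ (ψ (starRingEnd ℂ z) y) (ψ (starRingEnd ℂ w) x) =
      inner ℂ (ιL y) (R z (R (starRingEnd ℂ w) (ιL x))) := by
    intro x y
    rw [← inner_resolvent]
    simp [hψ, hγ, hPL, hPH, WithLp.prod_inner_apply]
  ext x
  refine ext_inner_left ℂ fun y => ?_
  have resolvent_identity := congrArg (fun S => inner ℂ (ιL y) (S (ιL x)))
    (sub_eq_smul_mul_of_resolvent (hR z hz).2 (hR _ hw').1)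
  simp only [sub_apply, smul_apply, mul_def, comp_apply, inner_sub_right, inner_smul_right,
    ← inner_ψ, ← inner_add] at resolvent_identity
  simp only [sub_apply, smul_apply, comp_apply, inner_sub_right, inner_smul_right,
    adjoint_inner_right, inner_ψ_left (ψ _ x)]
  linear_combination resolvent_identity
end

section
/- Let f, f' ∈ H and u, u' ∈ L satisfy T(f, u) = (f', u'), and let λ ∈ ℂ be nonreal. Then P_L( (T − λ)⁻¹ (f' − λ·f, 0) ) = φ(λ)u − ψ(λ)u'. (This is the identity E(λ)∘F(f' − λf) = φ(λ)u − ψ(λ)u' for the generalized Fourier transform associated with T and the scale L.) -/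
open ContinuousLinearMap

/-- If `T (f, u) = (f', u')` and `z` is nonreal, then
`P_L ((T - z)⁻¹ (f' - z • f, 0)) = φ z u - ψ z u'` (the identity
`E(λ) ∘ F (f' - λ f) = φ(λ) u - ψ(λ) u'` for the generalized Fourier transform). -/
theorem stmt_3
    {H L : Type*} [NormedAddCommGroup H] [InnerProductSpace ℂ H] [CompleteSpace H]
    [NormedAddCommGroup L] [InnerProductSpace ℂ L] [CompleteSpace L]
    (T : WithLp 2 (H × L) →L[ℂ] WithLp 2 (H × L)) (hT : IsSelfAdjoint T)
    (R : ℂ → WithLp 2 (H × L) →L[ℂ] WithLp 2 (H × L))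
    (hR : ∀ z : ℂ, z.im ≠ 0 → (T - z • 1) ∘L R z = 1 ∧ R z ∘L (T - z • 1) = 1)
    (ιL : L →L[ℂ] WithLp 2 (H × L))
    (hιL : ιL = (WithLp.prodContinuousLinearEquiv 2 ℂ H L).symm.toContinuousLinearMap ∘L
      ContinuousLinearMap.inr ℂ H L)
    (PL : WithLp 2 (H × L) →L[ℂ] L)
    (hPL : PL = ContinuousLinearMap.snd ℂ H L ∘L
      (WithLp.prodContinuousLinearEquiv 2 ℂ H L).toContinuousLinearMap)
    (ψ φ : ℂ → L →L[ℂ] L)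
    (hψ : ∀ z, ψ z = PL ∘L R z ∘L ιL)
    (hφ : ∀ z, φ z = 1 + z • ψ z)
    (f f' : H) (u u' : L)
    (hT' : T ((WithLp.equiv 2 (H × L)).symm (f, u)) = (WithLp.equiv 2 (H × L)).symm (f', u'))
    (z : ℂ) (hz : z.im ≠ 0) :
    PL (R z ((WithLp.equiv 2 (H × L)).symm (f' - z • f, 0))) = φ z u - ψ z u' := by
  have decomposition : (WithLp.equiv 2 (H × L)).symm (f' - z • f, 0) =
      (T - z • 1) ((WithLp.equiv 2 (H × L)).symm (f, u)) + z • ιL u - ιL u' := by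
    rw [sub_apply, hT', hιL]
    apply (WithLp.equiv 2 (H × L)).injective
    ext <;> simp
  have left_inverse : R z ((T - z • 1) ((WithLp.equiv 2 (H × L)).symm (f, u))) =
      (WithLp.equiv 2 (H × L)).symm (f, u) :=
    DFunLike.congr_fun (hR z hz).2 _
  have projection : PL ((WithLp.equiv 2 (H × L)).symm (f, u)) = u := by
    simp [hPL]
  rw [decomposition, map_sub, map_add, left_inverse, map_sub, map_add, projection, hφ, hψ]
  simp
end

section
/- For all λ, μ ∈ ℂ such that I − λ·B̃1 and I − μ·B̃1 are boundedly invertible, the resolvent matrix Θ satisfies the identity Θ(λ) ∘ J ∘ Θ(μ)† = J + i·(λ − conj μ)·C ∘ (I − λ·B̃1)⁻¹ ∘ (I − (conj μ)·B̃1†)⁻¹ ∘ C†. -/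
open ContinuousLinearMap

/-- For the resolvent matrix
`Θ(λ) = I + iλ • C ∘ (I - λ•B̃₁)⁻¹ ∘ C† ∘ J` (with `C h = (C̃₁ h, C̃₂ h)` and
`J (a, b) = (-i•b, i•a)` on `L ⊕₂ L`), under the identity
`B̃₁ - B̃₁† = C̃₁† C̃₂ - C̃₂† C̃₁`, one has
`Θ(λ) J Θ(μ)† = J + i(λ - conj μ) • C (I - λ•B̃₁)⁻¹ (I - conj μ • B̃₁†)⁻¹ C†`. -/
theorem stmt_11 {H L : Type*} [NormedAddCommGroup H] [InnerProductSpace ℂ H] [CompleteSpace H]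
    [NormedAddCommGroup L] [InnerProductSpace ℂ L] [CompleteSpace L]
    (B1 : H →L[ℂ] H) (C1 C2 : H →L[ℂ] L)
    (hA1 : B1 - adjoint B1 = adjoint C1 ∘L C2 - adjoint C2 ∘L C1)
    (C : H →L[ℂ] WithLp 2 (L × L))
    (hC : ∀ h : H, C h = (WithLp.equiv 2 (L × L)).symm (C1 h, C2 h))
    (J : WithLp 2 (L × L) →L[ℂ] WithLp 2 (L × L))
    (hJ : ∀ x : WithLp 2 (L × L), J x = (WithLp.equiv 2 (L × L)).symm
      (-Complex.I • ((WithLp.equiv 2 (L × L)) x).2, Complex.I • ((WithLp.equiv 2 (L × L)) x).1))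
    (Θ : ℂ → WithLp 2 (L × L) →L[ℂ] WithLp 2 (L × L))
    (hΘ : ∀ w : ℂ, Θ w = 1 + (Complex.I * w) •
      (C ∘L Ring.inverse (1 - w • B1) ∘L adjoint C ∘L J))
    (z w : ℂ) (hz : IsUnit (1 - z • B1)) (hw : IsUnit (1 - w • B1)) :
    Θ z ∘L J ∘L adjoint (Θ w) = J + (Complex.I * (z - starRingEnd ℂ w)) •
      (C ∘L Ring.inverse (1 - z • B1) ∘L
        Ring.inverse (1 - (starRingEnd ℂ w) • adjoint B1) ∘L adjoint C) := by
  have J_sq (x) : J (J x) = x := by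
    rw [hJ (J x), hJ x]
    apply (WithLp.equiv 2 (L × L)).injective
    ext <;> simp [smul_smul]
  have adjoint_J : adjoint J = J := by
    symm
    rw [eq_adjoint_iff]
    intro x y
    rw [hJ x, hJ y]
    simp [WithLp.prod_inner_apply, inner_smul_left, inner_smul_right]
    ring
  have adjoint_C_J_C (h : H) : adjoint C (J (C h)) = -Complex.I • (B1 h - adjoint B1 h) := by
    have hB : B1 h - adjoint B1 h = adjoint C1 (C2 h) - adjoint C2 (C1 h) := by
      simpa using DFunLike.congr_fun hA1 h
    rw [hB]
    refine ext_inner_right ℂ fun k => ?_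
    rw [adjoint_inner_left, hJ, hC h, hC k]
    simp [WithLp.prod_inner_apply, inner_smul_left, inner_sub_left, adjoint_inner_left]
    ring
  have adjoint_inverse : adjoint (Ring.inverse (1 - w • B1)) =
      Ring.inverse (1 - (starRingEnd ℂ w) • adjoint B1) := by
    simp only [← star_eq_adjoint]
    rw [← Ring.inverse_star]
    simp
  have hw' : IsUnit (1 - (starRingEnd ℂ w) • adjoint B1) := by
    have := hw.star
    simpa [star_eq_adjoint] using this
  have hR := Ring.inverse_mul_cancel _ hz
  have hS := Ring.mul_inverse_cancel _ hw'
  have adjoint_Θ : adjoint (Θ w) = 1 - (Complex.I * starRingEnd ℂ w) •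
      (J ∘L C ∘L Ring.inverse (1 - (starRingEnd ℂ w) • adjoint B1) ∘L adjoint C) := by
    rw [hΘ, map_add, map_smulₛₗ, adjoint_comp, adjoint_comp, adjoint_comp, adjoint_adjoint,
      adjoint_J, adjoint_inverse, ← star_eq_adjoint (1 : _ →L[ℂ] _), star_one]
    simp [sub_eq_add_neg, comp_assoc]
  rw [adjoint_Θ, hΘ]
  generalize Ring.inverse (1 - z • B1) = R at *
  generalize Ring.inverse (1 - (starRingEnd ℂ w) • adjoint B1) = S at *
  ext1 x
  have hSx : adjoint C x = S (adjoint C x) - starRingEnd ℂ w • adjoint B1 (S (adjoint C x)) := by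
    simpa using (DFunLike.congr_fun hS (adjoint C x)).symm
  have hRy (y : H) : R y - z • R (B1 y) = y := by
    simpa using DFunLike.congr_fun hR y
  simp only [coe_comp, Function.comp_apply, add_apply, sub_apply, smul_apply, one_apply_eq_self,
    map_sub, map_smul, J_sq, adjoint_C_J_C]
  generalize S (adjoint C x) = y at *
  rw [hSx]
  have hCy : C y = C (R y) - z • C (R (B1 y)) := by
    rw [← map_smul, ← map_sub, hRy]
  rw [hCy]
  simp only [map_sub, map_smul]
  match_scalars <;> ring_nf <;> simp
end

section
/- The following are equivalent: (1) there exists a finite nonnegative Borel measure σ on ℝ such that t ↦ t^j is σ-integrable and ∫ t^j dσ = s_j for all 0 ≤ j ≤ 2n−1, and ∫ t^{2n} dσ = s_{2n} (an "exact" solution of the truncated Hamburger moment problem); (2) the vector (s_{n+1}, …, s_{2n}) ∈ ℝ^n lies in the range of the n×n Hankel matrix S_{n−1} = (s_{i+j})_{i,j=0}^{n−1}; (3) there exist real numbers s_{2n+1}, s_{2n+2} such that the extended Hankel matrix S_{n+1} = (s_{i+j})_{i,j=0}^{n+1} is positive semidefinite. -/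
open MeasureTheory
open Matrix

/-- Orthogonal diagonalization of a real symmetric matrix. -/
theorem exists_orthogonal_diagonalization {m : Type*} [Fintype m] [DecidableEq m]
    {A : Matrix m m ℝ} (hA : A.IsHermitian) :
    ∃ (U : Matrix m m ℝ) (d : m → ℝ), Uᵀ * U = 1 ∧ d = hA.eigenvalues ∧
      A = U * diagonal d * Uᵀ := by
  refine ⟨hA.eigenvectorUnitary, hA.eigenvalues, ?_, rfl, ?_⟩
  · have h := Unitary.coe_star_mul_self hA.eigenvectorUnitary
    rwa [star_eq_conjTranspose, conjTranspose_eq_transpose_of_trivial] at h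
  · conv_lhs => rw [hA.spectral_theorem, Unitary.conjStarAlgAut_apply]
    rw [star_eq_conjTranspose, conjTranspose_eq_transpose_of_trivial]
    rfl

/-- A positive semidefinite real matrix factors as `Rᵀ * R` where `R` has a generalized
inverse `Q` such that `R * Q` is symmetric. -/
theorem Matrix.PosSemidef.exists_factor_generalized_inverse {m : Type*} [Fintype m]
    [DecidableEq m] {S : Matrix m m ℝ} (hS : S.PosSemidef) :
    ∃ R Q : Matrix m m ℝ, Rᵀ * R = S ∧ R * Q * R = R ∧ (R * Q)ᵀ = R * Q := by
  obtain ⟨U, d, hU, hd, h⟩ := exists_orthogonal_diagonalization hS.isHermitian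
  have hd0 : ∀ i, 0 ≤ d i := fun i => hd ▸ hS.eigenvalues_nonneg i
  have hRQ : diagonal (fun i => √(d i)) * Uᵀ * (U * diagonal fun i => (√(d i))⁻¹) =
      diagonal fun i => √(d i) * (√(d i))⁻¹ := by
    rw [Matrix.mul_assoc, ← Matrix.mul_assoc Uᵀ, hU, Matrix.one_mul, diagonal_mul_diagonal]
  refine ⟨diagonal (fun i => √(d i)) * Uᵀ, U * diagonal fun i => (√(d i))⁻¹, ?_, ?_, ?_⟩
  · rw [transpose_mul, transpose_transpose, diagonal_transpose, Matrix.mul_assoc,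
      ← Matrix.mul_assoc (diagonal _), diagonal_mul_diagonal, h]
    simp only [Real.mul_self_sqrt (hd0 _), Matrix.mul_assoc]
  · rw [hRQ, ← Matrix.mul_assoc, diagonal_mul_diagonal]
    simp only [mul_inv_mul_cancel]
  · rw [hRQ, diagonal_transpose]

/-- If `C` is symmetric with respect to a positive semidefinite form `S`, the sequence
`v ⬝ S Cᵏ v` is the moment sequence of a finitely supported nonnegative measure. -/
theorem exists_weights_nodes_of_symmetric {m : Type*} [Fintype m] [DecidableEq m]
    {S C : Matrix m m ℝ} (hS : S.PosSemidef) (hSC : Cᵀ * S = S * C) (v : m → ℝ) :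
    ∃ w x : m → ℝ, (∀ l, 0 ≤ w l) ∧ ∀ k : ℕ, v ⬝ᵥ (S * C ^ k) *ᵥ v = ∑ l, w l * x l ^ k := by
  obtain ⟨R, Q, rfl, hRQR, hRQ⟩ := hS.exists_factor_generalized_inverse
  set A := Qᵀ * (Rᵀ * R * C) * Q with hA
  have hAH : A.IsHermitian := by
    rw [IsHermitian, conjTranspose_eq_transpose_of_trivial, hA]
    simp only [← hSC, transpose_mul, transpose_transpose, Matrix.mul_assoc]
  have hker : R * (C * (Q * R - 1)) = 0 := by
    rw [← conjTranspose_mul_self_mul_eq_zero, conjTranspose_eq_transpose_of_trivial,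
      ← Matrix.mul_assoc, ← hSC, Matrix.mul_assoc, Matrix.mul_assoc, Matrix.mul_sub,
      ← Matrix.mul_assoc R, hRQR, Matrix.mul_one, sub_self, Matrix.mul_zero, Matrix.mul_zero]
  have hAR : A * R = R * C := by
    have h1 : A * R = R * C * (Q * R) := by
      calc A * R = (R * Q)ᵀ * R * C * (Q * R) := by
            simp only [hA, transpose_mul, Matrix.mul_assoc]
        _ = _ := by rw [hRQ, hRQR]
    rw [h1, ← sub_eq_zero, ← hker]
    simp only [Matrix.mul_sub, Matrix.mul_one, Matrix.mul_assoc]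
  have hpow : ∀ k : ℕ, A ^ k * R = R * C ^ k := by
    intro k
    induction k with
    | zero => simp
    | succ k ih => rw [pow_succ, Matrix.mul_assoc, hAR, ← Matrix.mul_assoc, ih,
        Matrix.mul_assoc, ← pow_succ]
  obtain ⟨W, x, hW, -, hAW⟩ := exists_orthogonal_diagonalization hAH
  have hApow : ∀ k : ℕ, A ^ k = W * diagonal (fun l => x l ^ k) * Wᵀ := by
    have hW' : W * Wᵀ = 1 := mul_eq_one_comm.mp hW
    intro k
    induction k with
    | zero => simp [hW']
    | succ k ih =>
      rw [pow_succ, ih, hAW]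
      calc W * diagonal (fun l => x l ^ k) * Wᵀ * (W * diagonal x * Wᵀ)
          = W * (diagonal (fun l => x l ^ k) * (Wᵀ * W) * diagonal x) * Wᵀ := by
            simp only [Matrix.mul_assoc]
        _ = _ := by rw [hW, Matrix.mul_one, diagonal_mul_diagonal]; simp only [pow_succ]
  refine ⟨fun l => ((Wᵀ * R) *ᵥ v) l ^ 2, x, fun l => sq_nonneg _, fun k => ?_⟩
  have : Rᵀ * R * C ^ k = (Wᵀ * R)ᵀ * (diagonal (fun l => x l ^ k) * (Wᵀ * R)) := by
    rw [Matrix.mul_assoc, ← hpow, hApow, transpose_mul, transpose_transpose]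
    simp only [Matrix.mul_assoc]
  rw [this]
  generalize Wᵀ * R = T
  rw [← mulVec_mulVec, ← mulVec_mulVec, dotProduct_mulVec, vecMul_transpose]
  simp only [dotProduct, mulVec_diagonal]
  exact Finset.sum_congr rfl fun l _ => by ring

/-- A vector annihilated by the kernel of a real symmetric matrix lies in its range. -/
theorem Matrix.IsHermitian.exists_mulVec_eq {m : Type*} [Fintype m] [DecidableEq m]
    {M : Matrix m m ℝ} (hM : M.IsHermitian) {b : m → ℝ}
    (hb : ∀ c, M *ᵥ c = 0 → c ⬝ᵥ b = 0) : ∃ x, M *ᵥ x = b := by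
  have hsym := isSymmetric_toEuclideanLin_iff.mpr hM
  have hmem : WithLp.toLp 2 b ∈ (LinearMap.range (toEuclideanLin M)) := by
    rw [← Submodule.orthogonal_orthogonal (LinearMap.range (toEuclideanLin M)),
      hsym.orthogonal_range]
    intro u hu
    have := hb u.ofLp (by simpa using congrArg WithLp.ofLp (LinearMap.mem_ker.mp hu))
    rw [EuclideanSpace.inner_eq_star_dotProduct, dotProduct_comm]
    simpa using this
  obtain ⟨x, hx⟩ := hmem
  exact ⟨x.ofLp, by simpa using congrArg WithLp.ofLp hx⟩

/-- A finitely supported measure with prescribed nonnegative weights, and its moments. -/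
theorem exists_measure_of_weights_nodes {m : Type*} [Fintype m] (w x : m → ℝ)
    (hw : ∀ l, 0 ≤ w l) :
    ∃ σ : Measure ℝ, ∀ k : ℕ, Integrable (fun t : ℝ => t ^ k) σ ∧
      ∫ t, t ^ k ∂σ = ∑ l, w l * x l ^ k := by
  have hint : ∀ (k : ℕ) (l : m),
      Integrable (fun t : ℝ => t ^ k) (ENNReal.ofReal (w l) • Measure.dirac (x l)) := fun k l =>
    (integrable_dirac (by simp)).smul_measure ENNReal.ofReal_ne_top
  refine ⟨∑ l, ENNReal.ofReal (w l) • Measure.dirac (x l), fun k => ⟨?_, ?_⟩⟩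
  · exact integrable_finsetSum_measure.mpr fun l _ => hint k l
  · rw [integral_finsetSum_measure fun l _ => hint k l]
    refine Finset.sum_congr rfl fun l _ => ?_
    rw [integral_smul_measure, integral_dirac, ENNReal.toReal_ofReal (hw l), smul_eq_mul]

/-- A square-integrable polynomial whose norm vanishes by the moment relations is orthogonal
to all monomials. -/
theorem sum_moment_eq_zero_of_kernel {n : ℕ} {s : ℕ → ℝ} {σ : Measure ℝ}
    (hint : ∀ j ≤ 2 * n, Integrable (fun t : ℝ => t ^ j) σ)
    (hmom : ∀ j ≤ 2 * n, ∫ t, t ^ j ∂σ = s j) {c : Fin n → ℝ}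
    (hc : (of fun i j : Fin n => s ((i : ℕ) + (j : ℕ))) *ᵥ c = 0) :
    c ⬝ᵥ (fun i : Fin n => s (n + 1 + (i : ℕ))) = 0 := by
  have hsq : ∀ t : ℝ, (∑ i, c i * t ^ (i : ℕ)) ^ 2 =
      ∑ i, ∑ j, c i * c j * t ^ ((i : ℕ) + (j : ℕ)) := by
    intro t
    rw [sq, Finset.sum_mul_sum]
    exact Finset.sum_congr rfl fun i _ => Finset.sum_congr rfl fun j _ => by ring
  have hi : ∀ i j : Fin n,
      Integrable (fun t : ℝ => c i * c j * t ^ ((i : ℕ) + (j : ℕ))) σ :=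
    fun i j => (hint _ (by omega)).const_mul _
  have hsqint : Integrable (fun t : ℝ => (∑ i, c i * t ^ (i : ℕ)) ^ 2) σ := by
    simp only [hsq]
    exact integrable_finsetSum _ fun i _ => integrable_finsetSum _ fun j _ => hi i j
  have hzero : ∫ t, (∑ i, c i * t ^ (i : ℕ)) ^ 2 ∂σ = 0 := by
    simp only [hsq]
    rw [integral_finsetSum _ fun i _ => integrable_finsetSum _ fun j _ => hi i j]
    refine Finset.sum_eq_zero fun i _ => ?_
    rw [integral_finsetSum _ fun j _ => hi i j]
    have := congrFun hc i
    simp only [mulVec, dotProduct, of_apply, Pi.zero_apply] at this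
    rw [← mul_zero (c i), ← this, Finset.mul_sum]
    refine Finset.sum_congr rfl fun j _ => ?_
    rw [integral_const_mul, hmom _ (by omega)]
    ring
  have hae := (integral_eq_zero_iff_of_nonneg (fun t => sq_nonneg _) hsqint).mp hzero
  have h : ∫ t, ∑ i, c i * t ^ (n + 1 + (i : ℕ)) ∂σ = 0 := by
    refine integral_eq_zero_of_ae ?_
    filter_upwards [hae] with t ht
    have ht' : ∑ i, c i * t ^ (i : ℕ) = 0 := by simpa using ht
    calc ∑ i, c i * t ^ (n + 1 + (i : ℕ)) = t ^ (n + 1) * ∑ i, c i * t ^ (i : ℕ) := by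
          rw [Finset.mul_sum]
          exact Finset.sum_congr rfl fun i _ => by ring
      _ = 0 := by rw [ht', mul_zero]
  rw [integral_finsetSum _ fun i _ => (hint _ (by omega)).const_mul _] at h
  rw [← h]
  refine Finset.sum_congr rfl fun i _ => ?_
  rw [integral_const_mul, hmom _ (by omega)]

/-- Kernel vectors of a leading block of a positive semidefinite matrix extend by zero to
kernel vectors of the whole matrix. -/
theorem Matrix.PosSemidef.sum_eq_zero_of_submatrix_kernel {m p : Type*} [Fintype m] [Fintype p]
    [DecidableEq p] {M : Matrix p p ℝ} (hM : M.PosSemidef) (f : m → p) {c : m → ℝ}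
    (hc : M.submatrix f f *ᵥ c = 0) (k : p) : ∑ i, M k (f i) * c i = 0 := by
  set P : Matrix p m ℝ := of fun a i => if a = f i then 1 else 0 with hP
  have hMP : ∀ a, (M *ᵥ P *ᵥ c) a = ∑ i, M a (f i) * c i := by
    intro a
    rw [mulVec_mulVec]
    simp [mulVec, dotProduct, hP, Matrix.mul_apply]
  have hq : star (P *ᵥ c) ⬝ᵥ M *ᵥ P *ᵥ c = 0 := by
    have hy : (M *ᵥ P *ᵥ c) ᵥ* P = 0 := by
      rw [funext hMP, ← hc]
      ext i
      simp [vecMul, hP, mulVec, dotProduct]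
    rw [star_trivial, dotProduct_comm, dotProduct_mulVec, hy, zero_dotProduct]
  rw [← hMP, (hM.dotProduct_mulVec_zero_iff _).mp hq, Pi.zero_apply]

/-- The columns expressing the monomials `1, …, t ^ (n + 1)` in the basis `1, …, t ^ n` modulo
`t ^ (n + 1) - ∑ j, x j * t ^ j`. -/
def monomialColumns {n : ℕ} (x : Fin n → ℝ) : Matrix (Fin (n + 1)) (Fin (n + 2)) ℝ :=
  of fun i j => Fin.lastCases (Fin.snoc (α := fun _ => ℝ) x 0 i)
    (fun k : Fin (n + 1) => if i = k then 1 else 0) j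

@[simp]
theorem monomialColumns_castSucc {n : ℕ} (x : Fin n → ℝ) (i k : Fin (n + 1)) :
    monomialColumns x i k.castSucc = if i = k then 1 else 0 := by
  simp [monomialColumns]

@[simp]
theorem monomialColumns_last {n : ℕ} (x : Fin n → ℝ) (i : Fin (n + 1)) :
    monomialColumns x i (Fin.last (n + 1)) = Fin.snoc (α := fun _ => ℝ) x 0 i := by
  simp [monomialColumns]

section Recursion

variable {n : ℕ} {s : ℕ → ℝ} {x : Fin n → ℝ}

theorem hankel_mul_monomialColumns
    (hx : ∀ i ≤ n + 1, s (n + 1 + i) = ∑ j : Fin n, s (i + j) * x j)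
    (i : Fin (n + 1)) (j : Fin (n + 2)) :
    ((of fun i j : Fin (n + 1) => s ((i : ℕ) + (j : ℕ))) * monomialColumns x) i j =
      s ((i : ℕ) + (j : ℕ)) := by
  induction j using Fin.lastCases with
  | last =>
    simp only [Matrix.mul_apply, of_apply, monomialColumns_last, Fin.sum_univ_castSucc,
      Fin.snoc_castSucc, Fin.snoc_last, mul_zero, add_zero, Fin.val_castSucc, Fin.val_last]
    rw [← hx i (by omega), add_comm]
  | cast k => simp [Matrix.mul_apply]

theorem posSemidef_hankel_succ
    (hx : ∀ i ≤ n + 1, s (n + 1 + i) = ∑ j : Fin n, s (i + j) * x j)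
    (hS : (of fun i j : Fin (n + 1) => s ((i : ℕ) + (j : ℕ))).PosSemidef) :
    (of fun i j : Fin (n + 2) => s ((i : ℕ) + (j : ℕ))).PosSemidef := by
  convert hS.conjTranspose_mul_mul_same (monomialColumns x) using 1
  ext i j
  rw [conjTranspose_eq_transpose_of_trivial, Matrix.mul_assoc, Matrix.mul_apply]
  simp only [hankel_mul_monomialColumns hx, transpose_apply, of_apply]
  induction i using Fin.lastCases with
  | last =>
    simp only [monomialColumns_last, Fin.sum_univ_castSucc, Fin.snoc_castSucc, Fin.snoc_last,
      zero_mul, add_zero, Fin.val_castSucc, Fin.val_last]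
    rw [hx j (by omega)]
    exact Finset.sum_congr rfl fun k _ => by rw [mul_comm, add_comm]
  | cast k => simp

theorem exists_measure_of_recursion
    (hx : ∀ i ≤ n + 1, s (n + 1 + i) = ∑ j : Fin n, s (i + j) * x j)
    (hS : (of fun i j : Fin (n + 1) => s ((i : ℕ) + (j : ℕ))).PosSemidef) :
    ∃ σ : Measure ℝ, (∀ j ≤ 2 * n, Integrable (fun t : ℝ => t ^ j) σ) ∧
      ∀ j ≤ 2 * n, ∫ t, t ^ j ∂σ = s j := by
  set S : Matrix (Fin (n + 1)) (Fin (n + 1)) ℝ := of fun i j => s ((i : ℕ) + (j : ℕ)) with hSdef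
  set C : Matrix (Fin (n + 1)) (Fin (n + 1)) ℝ := (monomialColumns x).submatrix id Fin.succ
    with hC
  have hSCij : ∀ i j, (S * C) i j = s ((i : ℕ) + (j : ℕ) + 1) := fun i j => by
    have := hankel_mul_monomialColumns hx i j.succ
    rwa [Fin.val_succ, ← add_assoc] at this
  have hST : Sᵀ = S := by
    ext i j
    simp [hSdef, add_comm]
  have hSC : Cᵀ * S = S * C := by
    rw [← hST, ← transpose_mul, hST]
    ext i j
    rw [transpose_apply, hSCij, hSCij, add_comm (j : ℕ)]
  obtain ⟨w, y, hw, hwy⟩ := exists_weights_nodes_of_symmetric hS hSC (Pi.single 0 1)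
  have hcol : ∀ (k : ℕ) (hk : k < n + 1),
      C ^ k *ᵥ Pi.single 0 1 = (Pi.single ⟨k, hk⟩ 1 : Fin (n + 1) → ℝ) := by
    intro k
    induction k with
    | zero => intro hk; rw [pow_zero, one_mulVec]; rfl
    | succ k ih =>
      intro hk
      rw [pow_succ', ← mulVec_mulVec, ih (by omega), mulVec_single_one]
      ext i
      have : (⟨k, by omega⟩ : Fin (n + 1)).succ = (⟨k + 1, hk⟩ : Fin (n + 1)).castSucc := rfl
      rw [col_apply, hC, submatrix_apply, this, monomialColumns_castSucc, Pi.single_apply, id]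
  have hpow : ∀ i : ℕ, (C ^ i)ᵀ * S = S * C ^ i := by
    intro i
    induction i with
    | zero => simp
    | succ i ih => rw [pow_succ, transpose_mul, Matrix.mul_assoc, ih, ← Matrix.mul_assoc, hSC,
        Matrix.mul_assoc, ← pow_succ', pow_succ]
  have hmom : ∀ k ≤ 2 * n, ∑ l, w l * y l ^ k = s k := by
    intro k hk
    obtain ⟨i, j, hi, hj, rfl⟩ : ∃ i j, i < n + 1 ∧ j < n + 1 ∧ k = i + j :=
      ⟨min k n, k - min k n, by omega, by omega, by omega⟩
    rw [← hwy, pow_add, ← Matrix.mul_assoc, ← hpow, Matrix.mul_assoc, ← mulVec_mulVec,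
      ← mulVec_mulVec, hcol j hj, dotProduct_mulVec, vecMul_transpose, hcol i hi]
    simp [hSdef]
  obtain ⟨σ, hσ⟩ := exists_measure_of_weights_nodes w y hw
  exact ⟨σ, fun j _ => (hσ j).1, fun j hj => (hσ j).2.trans (hmom j hj)⟩

/-- A solution of the range condition yields a two-step extension of the moment sequence
satisfying the associated recursion. -/
theorem exists_recursive_extension
    (hx : (of fun i j : Fin n => s ((i : ℕ) + (j : ℕ))) *ᵥ x =
      fun i : Fin n => s (n + 1 + (i : ℕ))) :
    ∃ s' : ℕ → ℝ, (∀ k ≤ 2 * n, s' k = s k) ∧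
      ∀ i ≤ n + 1, s' (n + 1 + i) = ∑ j : Fin n, s' (i + j) * x j := by
  set a := ∑ j : Fin n, s (n + j) * x j with ha
  set u : ℕ → ℝ := Function.update s (2 * n + 1) a with hu
  set b := ∑ j : Fin n, u (n + 1 + j) * x j with hb
  have hus : ∀ k ≤ 2 * n, u k = s k := fun k hk => Function.update_of_ne (by omega) _ _
  have hs' : ∀ k ≤ 2 * n + 1, Function.update u (2 * n + 2) b k = u k :=
    fun k hk => Function.update_of_ne (by omega) _ _
  refine ⟨Function.update u (2 * n + 2) b, fun k hk => ?_, fun i hi => ?_⟩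
  · rw [hs' k (by omega), hus k hk]
  · have hsum : ∑ j : Fin n, Function.update u (2 * n + 2) b (i + j) * x j =
        ∑ j : Fin n, u (i + j) * x j :=
      Finset.sum_congr rfl fun j _ => by rw [hs' _ (by omega)]
    rw [hsum]
    rcases (by omega : i = n + 1 ∨ i ≤ n) with rfl | hin
    · rw [show n + 1 + (n + 1) = 2 * n + 2 by ring, Function.update_self]
    · rw [hs' _ (by omega)]
      have hsum' : ∑ j : Fin n, u (i + j) * x j = ∑ j : Fin n, s (i + j) * x j :=
        Finset.sum_congr rfl fun j _ => by rw [hus _ (by omega)]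
      rw [hsum']
      rcases (by omega : i = n ∨ i < n) with rfl | hin'
      · rw [show i + 1 + i = 2 * i + 1 by ring, hu, Function.update_self]
      · rw [hus _ (by omega)]
        exact (congrFun hx ⟨i, hin'⟩).symm

end Recursion

/-- Scalar truncated Hamburger moment problem: for real numbers
`s₀, …, s_{2n}` with positive semidefinite Hankel matrix `Sₙ = (s_{i+j})_{i,j=0}^n`,
the following are equivalent: (1) existence of an "exact" solution `σ` with
`∫ t^j dσ = s_j` for `0 ≤ j ≤ 2n`; (2) `(s_{n+1}, …, s_{2n})` lies in the range of
`S_{n-1}`; (3) the Hankel matrix can be extended to a positive semidefinite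
`S_{n+1}` by choosing real `s_{2n+1}, s_{2n+2}`. -/
theorem stmt_18 (n : ℕ) (hn : 1 ≤ n) (s : ℕ → ℝ)
    (hS : (Matrix.of fun i j : Fin (n + 1) => s ((i : ℕ) + (j : ℕ))).PosSemidef) :
    ((∃ σ : Measure ℝ, (∀ j ≤ 2 * n, Integrable (fun t : ℝ => t ^ j) σ) ∧
        (∀ j ≤ 2 * n, ∫ t, t ^ j ∂σ = s j)) ↔
      (∃ x : Fin n → ℝ, (Matrix.of fun i j : Fin n => s ((i : ℕ) + (j : ℕ))).mulVec x
          = fun i : Fin n => s (n + 1 + (i : ℕ)))) ∧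
    ((∃ x : Fin n → ℝ, (Matrix.of fun i j : Fin n => s ((i : ℕ) + (j : ℕ))).mulVec x
          = fun i : Fin n => s (n + 1 + (i : ℕ))) ↔
      (∃ s' : ℕ → ℝ, (∀ k ≤ 2 * n, s' k = s k) ∧
        (Matrix.of fun i j : Fin (n + 2) => s' ((i : ℕ) + (j : ℕ))).PosSemidef)) := by
  have hH : (Matrix.of fun i j : Fin n => s ((i : ℕ) + (j : ℕ))).IsHermitian := by
    ext i j
    simp [add_comm]
  have hext : (∃ x : Fin n → ℝ, (Matrix.of fun i j : Fin n => s ((i : ℕ) + (j : ℕ))).mulVec x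
      = fun i : Fin n => s (n + 1 + (i : ℕ))) →
      ∃ (x : Fin n → ℝ) (s' : ℕ → ℝ), (∀ k ≤ 2 * n, s' k = s k) ∧
        (∀ i ≤ n + 1, s' (n + 1 + i) = ∑ j : Fin n, s' (i + j) * x j) ∧
        (Matrix.of fun i j : Fin (n + 1) => s' ((i : ℕ) + (j : ℕ))).PosSemidef := by
    rintro ⟨x, hx⟩
    obtain ⟨s', hs', hrec⟩ := exists_recursive_extension hx
    refine ⟨x, s', hs', hrec, ?_⟩
    have heq : (Matrix.of fun i j : Fin (n + 1) => s' ((i : ℕ) + (j : ℕ))) =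
        Matrix.of fun i j : Fin (n + 1) => s ((i : ℕ) + (j : ℕ)) := by
      ext i j
      simp [hs' _ (by omega : (i : ℕ) + j ≤ 2 * n)]
    rwa [heq]
  refine ⟨⟨?_, fun h => ?_⟩, ⟨fun h => ?_, ?_⟩⟩
  · rintro ⟨σ, hint, hmom⟩
    exact hH.exists_mulVec_eq fun c hc => sum_moment_eq_zero_of_kernel hint hmom hc
  · obtain ⟨x, s', hs', hrec, hpos⟩ := hext h
    obtain ⟨σ, hint, hmom⟩ := exists_measure_of_recursion hrec hpos
    exact ⟨σ, hint, fun j hj => (hmom j hj).trans (hs' j hj)⟩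
  · obtain ⟨x, s', hs', hrec, hpos⟩ := hext h
    exact ⟨s', hs', posSemidef_hankel_succ hrec hpos⟩
  · rintro ⟨s', hs', hpos⟩
    refine hH.exists_mulVec_eq fun c hc => ?_
    have hsub : (Matrix.of fun i j : Fin (n + 2) => s' ((i : ℕ) + (j : ℕ))).submatrix
        (fun i : Fin n => i.castSucc.castSucc) (fun i : Fin n => i.castSucc.castSucc) =
        Matrix.of fun i j : Fin n => s ((i : ℕ) + (j : ℕ)) := by
      ext i j
      simp [hs' _ (by omega : (i : ℕ) + j ≤ 2 * n)]
    have := hpos.sum_eq_zero_of_submatrix_kernel _ (hsub ▸ hc) (Fin.last (n + 1))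
    rw [← this]
    refine Finset.sum_congr rfl fun i _ => ?_
    simp [hs' _ (by omega : n + 1 + (i : ℕ) ≤ 2 * n), mul_comm]
end

section
/- Suppose the block Hankel matrix S_n is positive semidefinite and the column space of the (nd)×d block column matrix col(s_{n+1}, …, s_{2n}) is contained in the column space of the block Hankel matrix S_{n−1} = (s_{i+j})_{i,j=0}^{n−1}. Then there exists a Hermitian matrix X ∈ ℂ^{N×N} with rank X = rank S_n such that X·S_n·X = X, S_n·X·S_n = S_n, and T·(range X) ⊆ range X, where range denotes the column space of a matrix. -/
open Matrix
open scoped ComplexOrder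

namespace Bolotnikov

/-- A Hermitian matrix has a Hermitian reflexive generalized inverse. -/
theorem exists_hermitian_reflexive_inverse {ι : Type*} [Fintype ι] [DecidableEq ι]
    {S : Matrix ι ι ℂ} (hS : S.IsHermitian) :
    ∃ G : Matrix ι ι ℂ, G.IsHermitian ∧ S * G * S = S ∧ G * S * G = G := by
  set φ := Unitary.conjStarAlgAut ℂ _ hS.eigenvectorUnitary
  have hspec : S = φ (diagonal fun i => (hS.eigenvalues i : ℂ)) := hS.spectral_theorem
  generalize hS.eigenvalues = x at hspec
  refine ⟨φ (diagonal fun i => (x i : ℂ)⁻¹), ?_, ?_, ?_⟩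
  · rw [Matrix.IsHermitian, ← star_eq_conjTranspose, ← map_star, star_eq_conjTranspose,
      diagonal_conjTranspose]
    congr 2
    ext i
    simp
  all_goals
    rw [hspec, ← map_mul, ← map_mul, diagonal_mul_diagonal, diagonal_mul_diagonal]
    congr 2
    ext i
    by_cases h : (x i : ℂ) = 0 <;> simp [h]

/-- A Hermitian matrix has a Hermitian reflexive generalized inverse whose range is any
prescribed complement of its kernel. -/
theorem exists_hermitian_inverse_range_eq {ι : Type*} [Fintype ι] [DecidableEq ι]
    {S : Matrix ι ι ℂ} (hS : S.IsHermitian) {V : Submodule ℂ (ι → ℂ)}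
    (hV : IsCompl V (LinearMap.ker (toLin' S))) :
    ∃ X : Matrix ι ι ℂ, X.IsHermitian ∧ X * S * X = X ∧ S * X * S = S ∧
      LinearMap.range (toLin' X) = V := by
  obtain ⟨G, hG, hSGS, hGSG⟩ := exists_hermitian_reflexive_inverse hS
  set P : Matrix ι ι ℂ := LinearMap.toMatrix' (Submodule.projection _ _ hV)
  have hPlin : toLin' P = Submodule.projection _ _ hV := toLin'_toMatrix' _
  have hSP : S * P = S := by
    apply toLin'.injective
    refine LinearMap.ext fun v => ?_
    rw [toLin'_mul, hPlin, LinearMap.comp_apply]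
    have h := Submodule.projection_add_projection_eq_self hV v
    have hk : toLin' S (Submodule.projection _ _ hV.symm v) = 0 :=
      Submodule.projection_apply_mem hV.symm v
    conv_rhs => rw [← h, map_add, hk, add_zero]
  have hPS : Pᴴ * S = S := by
    have := congrArg conjTranspose hSP
    rwa [conjTranspose_mul, hS.eq] at this
  have hSXS : S * (P * G * Pᴴ) * S = S := by
    calc S * (P * G * Pᴴ) * S = (S * P) * G * (Pᴴ * S) := by simp only [Matrix.mul_assoc]
      _ = S := by rw [hSP, hPS, hSGS]
  have hle : LinearMap.range (toLin' (P * G * Pᴴ)) ≤ V := by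
    rintro _ ⟨v, rfl⟩
    rw [Matrix.mul_assoc, toLin'_mul, hPlin]
    exact Submodule.projection_apply_mem hV _
  refine ⟨P * G * Pᴴ, isHermitian_mul_mul_conjTranspose P hG, ?_, hSXS, le_antisymm hle ?_⟩
  · calc P * G * Pᴴ * S * (P * G * Pᴴ) = P * (G * ((Pᴴ * S) * P) * G) * Pᴴ := by
          simp only [Matrix.mul_assoc]
      _ = P * G * Pᴴ := by rw [hPS, hSP, hGSG]
  · intro v hv
    have hmem : v - toLin' (P * G * Pᴴ) (toLin' S v) ∈ V ⊓ LinearMap.ker (toLin' S) := by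
      refine ⟨sub_mem hv (hle ⟨_, rfl⟩), ?_⟩
      rw [SetLike.mem_coe, LinearMap.mem_ker, map_sub, ← toLin'_mul_apply, ← toLin'_mul_apply, hSXS, sub_self]
    rw [hV.inf_eq_bot, Submodule.mem_bot, sub_eq_zero] at hmem
    exact ⟨_, hmem.symm⟩

/-- The `k`-th block of a block vector, as a Euclidean vector. -/
noncomputable def row {m d : ℕ} (k : Fin m) :
    (Fin m × Fin d → ℂ) →ₗ[ℂ] EuclideanSpace ℂ (Fin d) where
  toFun h := WithLp.toLp 2 fun b => h (k, b)
  map_add' _ _ := rfl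
  map_smul' _ _ := rfl

@[simp]
theorem row_apply {m d : ℕ} (k : Fin m) (h : Fin m × Fin d → ℂ) (b : Fin d) :
    row k h b = h (k, b) := rfl

/-- The `k`-th blocks of those vectors in `K` whose blocks after the `k`-th vanish. -/
noncomputable def leading {m d : ℕ} (K : Submodule ℂ (Fin m × Fin d → ℂ)) (k : Fin m) :
    Submodule ℂ (EuclideanSpace ℂ (Fin d)) :=
  (K ⊓ ⨅ j : {j : Fin m // k < j}, LinearMap.ker (row j.1)).map (row k)

theorem mem_leading {m d : ℕ} {K : Submodule ℂ (Fin m × Fin d → ℂ)} {k : Fin m}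
    {c : EuclideanSpace ℂ (Fin d)} :
    c ∈ leading K k ↔ ∃ h ∈ K, (∀ j, k < j → row j h = 0) ∧ row k h = c := by
  simp [leading, Submodule.mem_iInf, and_assoc]

/-- The block vectors whose blocks are orthogonal to the leading blocks of `K`. -/
noncomputable def leadingCompl {m d : ℕ} (K : Submodule ℂ (Fin m × Fin d → ℂ)) :
    Submodule ℂ (Fin m × Fin d → ℂ) :=
  ⨅ k, (leading K k)ᗮ.comap (row k)

theorem mem_leadingCompl {m d : ℕ} {K : Submodule ℂ (Fin m × Fin d → ℂ)}
    {h : Fin m × Fin d → ℂ} : h ∈ leadingCompl K ↔ ∀ k, row k h ∈ (leading K k)ᗮ := by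
  simp [leadingCompl, Submodule.mem_iInf]

theorem eq_zero_of_row_eq_zero {m d : ℕ} {h : Fin m × Fin d → ℂ} (H : ∀ k, row k h = 0) :
    h = 0 := by
  ext ⟨k, b⟩
  exact congrArg (fun v => v b) (H k)

theorem isCompl_leadingCompl {m d : ℕ} (K : Submodule ℂ (Fin m × Fin d → ℂ)) :
    IsCompl (leadingCompl K) K := by
  constructor
  · rw [Submodule.disjoint_def]
    intro h hV hK
    refine eq_zero_of_row_eq_zero fun k => ?_
    induction k using WellFoundedGT.induction with
    | ind k ih =>
      have h1 : row k h ∈ leading K k := mem_leading.2 ⟨h, hK, ih, rfl⟩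
      exact (Submodule.disjoint_def.1 (leading K k).orthogonal_disjoint) _ h1
        (mem_leadingCompl.1 hV k)
  · rw [codisjoint_iff, eq_top_iff]
    suffices H : ∀ l : ℕ, ∀ h : Fin m × Fin d → ℂ,
        (∀ j : Fin m, l ≤ j → row j h = 0) → h ∈ leadingCompl K ⊔ K by
      intro h _
      exact H m h fun j hj => absurd j.2 (by omega)
    intro l
    induction l with
    | zero =>
      intro h hh
      rw [eq_zero_of_row_eq_zero fun k => hh k (Nat.zero_le _)]
      exact zero_mem _
    | succ l ih =>
      intro h hh
      by_cases hl : l < m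
      swap
      · exact ih h fun j hj => absurd j.2 (by omega)
      obtain ⟨c, hc, w, hw, hcw⟩ := (leading K ⟨l, hl⟩).exists_add_mem_mem_orthogonal
        (row ⟨l, hl⟩ h)
      obtain ⟨g, hgK, hg0, rfl⟩ := mem_leading.1 hc
      set e : Fin m × Fin d → ℂ := fun p => if p.1 = ⟨l, hl⟩ then w p.2 else 0 with he
      have hel : row ⟨l, hl⟩ e = w := by
        ext b
        simp [he]
      have hej : ∀ j, j ≠ ⟨l, hl⟩ → row j e = 0 := by
        intro j hj
        ext b
        simp [he, hj]
      have heV : e ∈ leadingCompl K := by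
        refine mem_leadingCompl.2 fun k => ?_
        by_cases hk : k = ⟨l, hl⟩
        · rw [hk, hel]
          exact hw
        · rw [hej k hk]
          exact zero_mem _
      have hrest : h - (e + g) ∈ leadingCompl K ⊔ K := by
        refine ih _ fun j hj => ?_
        rw [map_sub, map_add]
        rcases hj.eq_or_lt with hj | hj
        · obtain rfl : j = ⟨l, hl⟩ := Fin.ext hj.symm
          rw [hel, hcw, add_comm, sub_self]
        · rw [hh j hj, hg0 j (Fin.lt_def.2 hj),
            hej j (fun h' => by rw [h'] at hj; exact lt_irrefl _ hj)]
          simp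
      have := add_mem hrest (Submodule.add_mem_sup heV hgK)
      rwa [sub_add_cancel] at this

/-- If `K` is stable under shifting down vectors with zero last block, then `leadingCompl K` is
stable under shifting up. -/
theorem shift_mem_leadingCompl {n d : ℕ} {K : Submodule ℂ (Fin (n + 1) × Fin d → ℂ)}
    (hK : ∀ h ∈ K, (∀ b, h (Fin.last n, b) = 0) → ∀ g : Fin (n + 1) × Fin d → ℂ,
      (∀ b, g (0, b) = 0) → (∀ (i : Fin n) b, g (i.succ, b) = h (i.castSucc, b)) → g ∈ K)
    {h g : Fin (n + 1) × Fin d → ℂ} (hh : h ∈ leadingCompl K)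
    (hlast : ∀ b, g (Fin.last n, b) = 0)
    (hshift : ∀ (i : Fin n) b, g (i.castSucc, b) = h (i.succ, b)) :
    g ∈ leadingCompl K := by
  have hmono : ∀ i : Fin n, leading K i.castSucc ≤ leading K i.succ := by
    intro i c hc
    obtain ⟨f, hf, hf0, rfl⟩ := mem_leading.1 hc
    have hf0' : ∀ j, i.castSucc < j → ∀ b, f (j, b) = 0 := by
      intro j hj b
      exact congrArg (fun v => v b) (hf0 j hj)
    refine mem_leading.2 ⟨fun p => Fin.cases 0 (fun j => f (j.castSucc, p.2)) p.1,
      hK f hf (hf0' _ (Fin.castSucc_lt_last i)) _ (fun b => rfl) (fun j b => rfl), ?_, rfl⟩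
    intro j hj
    obtain ⟨j, rfl⟩ := Fin.exists_succ_eq.2 (Fin.ne_zero_of_lt hj)
    ext b
    exact hf0' j.castSucc (by simpa using hj) b
  refine mem_leadingCompl.2 fun k => ?_
  induction k using Fin.lastCases with
  | last =>
    have : row (Fin.last n) g = 0 := by
      ext b
      exact hlast b
    rw [this]
    exact zero_mem _
  | cast i =>
    have : row i.castSucc g = row i.succ h := by
      ext b
      exact hshift i b
    rw [this]
    exact Submodule.orthogonal_le (hmono i) (mem_leadingCompl.1 hh i.succ)

end Bolotnikov

open Bolotnikov in
/-- (Bolotnikov's lemma.)  If the block Hankel matrix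
`Sₙ = (s_{i+j})_{i,j=0}^n` is positive semidefinite and the column space of
`col(s_{n+1}, …, s_{2n})` is contained in that of `S_{n-1}`, then there is a Hermitian
`X` with `rank X = rank Sₙ`, `X Sₙ X = X`, `Sₙ X Sₙ = Sₙ`, and `T (range X) ⊆ range X`,
where `T` is the block upward shift. -/
theorem stmt_19 (n d : ℕ) (hn : 0 < n) (hd : 0 < d)
    (s : ℕ → Matrix (Fin d) (Fin d) ℂ)
    (Sn : Matrix (Fin (n + 1) × Fin d) (Fin (n + 1) × Fin d) ℂ)
    (hSn : ∀ p q, Sn p q = s ((p.1 : ℕ) + (q.1 : ℕ)) p.2 q.2)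
    (hpsd : Sn.PosSemidef)
    (Sn1 : Matrix (Fin n × Fin d) (Fin n × Fin d) ℂ)
    (hSn1 : ∀ p q, Sn1 p q = s ((p.1 : ℕ) + (q.1 : ℕ)) p.2 q.2)
    (Col : Matrix (Fin n × Fin d) (Fin d) ℂ)
    (hCol : ∀ p b, Col p b = s (n + 1 + (p.1 : ℕ)) p.2 b)
    (hran : LinearMap.range (Matrix.toLin' Col) ≤ LinearMap.range (Matrix.toLin' Sn1))
    (T : Matrix (Fin (n + 1) × Fin d) (Fin (n + 1) × Fin d) ℂ)
    (hT : ∀ p q, T p q = if (q.1 : ℕ) = (p.1 : ℕ) + 1 ∧ p.2 = q.2 then 1 else 0) :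
    ∃ X : Matrix (Fin (n + 1) × Fin d) (Fin (n + 1) × Fin d) ℂ,
      X.IsHermitian ∧ X.rank = Sn.rank ∧ X * Sn * X = X ∧ Sn * X * Sn = Sn ∧
      Submodule.map (Matrix.toLin' T) (LinearMap.range (Matrix.toLin' X))
        ≤ LinearMap.range (Matrix.toLin' X) := by
  have hs : ∀ i j : Fin (n + 1), ∀ a b, star (s (i + j) b a) = s (i + j) a b := by
    intro i j a b
    have := hpsd.isHermitian.apply (i, a) (j, b)
    rwa [hSn, hSn, add_comm (j : ℕ) (i : ℕ)] at this
  have hK : ∀ h ∈ LinearMap.ker (toLin' Sn), (∀ b, h (Fin.last n, b) = 0) →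
      ∀ g : Fin (n + 1) × Fin d → ℂ, (∀ b, g (0, b) = 0) →
      (∀ (i : Fin n) b, g (i.succ, b) = h (i.castSucc, b)) →
      g ∈ LinearMap.ker (toLin' Sn) := by
    intro h hh hlast g hg0 hg
    have hrow : ∀ (i : Fin (n + 1)) a,
        ∑ q : Fin n × Fin d, s (i + q.1) a q.2 * h (q.1.castSucc, q.2) = 0 := by
      intro i a
      have := congrFun (LinearMap.mem_ker.1 hh) (i, a)
      simpa [toLin'_apply, mulVec, dotProduct, hSn, Fintype.sum_prod_type,
        Fin.sum_univ_castSucc, hlast] using this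
    have hCol0 : ∀ a,
        ∑ q : Fin n × Fin d, s (n + 1 + q.1) a q.2 * h (q.1.castSucc, q.2) = 0 := by
      intro a
      obtain ⟨y, hy⟩ := hran ⟨Pi.single a 1, rfl⟩
      have hy' : ∀ q : Fin n × Fin d,
          s (n + 1 + q.1) q.2 a = ∑ p : Fin n × Fin d, s (q.1 + p.1) q.2 p.2 * y p := by
        intro q
        have := congrFun hy q
        simp only [toLin'_apply, mulVec_single_one, col_apply, hCol] at this
        rw [← this]
        simp [mulVec, dotProduct, hSn1]
      have hstar : ∀ q : Fin n × Fin d, s (n + 1 + q.1) a q.2 =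
          ∑ p : Fin n × Fin d, s (p.1 + q.1) p.2 q.2 * star (y p) := by
        intro q
        have h1 := hs (Fin.last n) q.1.succ a q.2
        have e1 : ((Fin.last n : Fin (n + 1)) : ℕ) + (q.1.succ : Fin (n + 1)) = n + 1 + q.1 := by
          simp; omega
        rw [e1] at h1
        rw [← h1, hy' q, star_sum]
        refine Finset.sum_congr rfl fun p _ => ?_
        have h2 := hs q.1.castSucc p.1.castSucc p.2 q.2
        simp only [Fin.val_castSucc] at h2
        rw [star_mul', h2, add_comm (q.1 : ℕ)]
      simp only [hstar, Finset.sum_mul]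
      rw [Finset.sum_comm]
      refine Finset.sum_eq_zero fun p _ => ?_
      have := hrow p.1.castSucc p.2
      simp only [Fin.val_castSucc] at this
      rw [← mul_zero (star (y p)), ← this, Finset.mul_sum]
      exact Finset.sum_congr rfl fun q _ => by ring
    rw [LinearMap.mem_ker]
    ext ⟨i, a⟩
    have hexp : toLin' Sn g (i, a) =
        ∑ q : Fin n × Fin d, s (i + 1 + q.1) a q.2 * h (q.1.castSucc, q.2) := by
      simp [toLin'_apply, mulVec, dotProduct, hSn, Fintype.sum_prod_type, Fin.sum_univ_succ,
        hg0, hg, add_assoc, add_comm 1]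
    rw [hexp]
    induction i using Fin.lastCases with
    | last => simpa using hCol0 a
    | cast i => simpa using hrow i.succ a
  obtain ⟨X, hX, hXSX, hSXS, hrange⟩ :=
    exists_hermitian_inverse_range_eq hpsd.isHermitian (isCompl_leadingCompl _)
  refine ⟨X, hX, le_antisymm ?_ ?_, hXSX, hSXS, ?_⟩
  · rw [← hXSX]
    exact (rank_mul_le_left _ _).trans (rank_mul_le_right _ _)
  · conv_lhs => rw [← hSXS]
    exact (rank_mul_le_left _ _).trans (rank_mul_le_right _ _)
  · rw [hrange]
    rintro _ ⟨h, hh, rfl⟩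
    refine shift_mem_leadingCompl hK hh (fun b => ?_) fun i b => ?_
    · simp only [toLin'_apply, mulVec, dotProduct, hT]
      refine Finset.sum_eq_zero fun q _ => ?_
      have := q.1.2
      rw [if_neg (by simp; omega), zero_mul]
    · simp only [toLin'_apply, mulVec, dotProduct, hT]
      rw [Finset.sum_eq_single (i.succ, b)]
      · simp
      · rintro ⟨j, c⟩ - hq
        rw [if_neg, zero_mul]
        rintro ⟨h1, h2⟩
        exact hq (Prod.ext (Fin.ext (by simpa using h1)) h2.symm)
      · simp
end
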